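/- Let X be a compact I-favorable Hausdorff space. Then X is homeomorphic to the limit of a σ-complete inverse system {X_σ, π^σ_ρ, Σ} in which every X_σ is a compact metrizable space and every bonding map π^σ_ρ is a skeletal surjection. -/

import Mathlib

open Set Topology

/-- The equivalence relation identifying points lying in exactly the same members of `P`. -/
def pSetoid {X : Type*} (P : Set (Set X)) : Setoid X where
  r x y := ∀ V ∈ P, x ∈ V ↔ y ∈ V
  iseqv := ⟨fun _ _ _ => Iff.rfl, fun h V hV => (h V hV).symm,
    fun h1 h2 V hV => (h1 V hV).trans (h2 V hV)⟩

/-- The quotient `X/P`. -/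
def pQuot {X : Type*} (P : Set (Set X)) : Type _ := Quotient (pSetoid P)

/-- The `Q_P`-map `q : X → X/P`. -/
def pMap {X : Type*} (P : Set (Set X)) : X → pQuot P := Quotient.mk (pSetoid P)

/-- The `Q_P`-topology on `X/P`, generated by the images `q[V]`, `V ∈ P`. -/
def pTop {X : Type*} (P : Set (Set X)) : TopologicalSpace (pQuot P) :=
  TopologicalSpace.generateFrom {S | ∃ V ∈ P, S = pMap P '' V}

/-- `R_seq`: sets `W` that are unions `⋃ₙ Uₙ` with `Uₖ ⊆ X \ Vₖ ⊆ Uₖ₊₁`, `Uₙ, Vₙ ∈ R`. -/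
def seqFam {X : Type*} (R : Set (Set X)) : Set (Set X) :=
  {W | ∃ U V : ℕ → Set X, (∀ n, U n ∈ R) ∧ (∀ n, V n ∈ R) ∧
    (∀ k, U k ⊆ (V k)ᶜ ∧ (V k)ᶜ ⊆ U (k + 1)) ∧ (⋃ n, U n) = W}

/-- The family of cozero sets of `X`. -/
def cozeroFam (X : Type*) [TopologicalSpace X] : Set (Set X) :=
  {W | ∃ f : X → ℝ, Continuous f ∧ (∀ x, f x ∈ Set.Icc (0 : ℝ) 1) ∧ W = f ⁻¹' Set.Ioc 0 1}

/-- A skeletal map: a continuous surjection such that the closure of the image of every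
nonempty open set has nonempty interior. -/
def IsSkeletal {X Y : Type*} [TopologicalSpace X] [TopologicalSpace Y] (f : X → Y) : Prop :=
  Continuous f ∧ Function.Surjective f ∧
    ∀ U : Set X, IsOpen U → U.Nonempty → (interior (closure (f '' U))).Nonempty

/-- A skeletal family of open subsets of `X`. -/
def SkeletalFamily {X : Type*} [TopologicalSpace X] (P : Set (Set X)) : Prop :=
  ∀ V : Set X, IsOpen V → V.Nonempty →
    ∃ W ∈ P, ∀ U ∈ P, U ⊆ W → U.Nonempty → (U ∩ V).Nonempty

/-- A π-base: a family of nonempty open sets such that every nonempty open set contains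
a member of the family. -/
def IsPiBase {Y : Type*} [TopologicalSpace Y] (B : Set (Set Y)) : Prop :=
  (∀ b ∈ B, IsOpen b ∧ b.Nonempty) ∧ ∀ U : Set Y, IsOpen U → U.Nonempty → ∃ b ∈ B, b ⊆ U

/-- A strategy for Player I in the open-open game produces nonempty open sets. -/
def ValidStrategy {X : Type*} [TopologicalSpace X] (σ : List (Set X) → Set X) : Prop :=
  ∀ l : List (Set X), IsOpen (σ l) ∧ (σ l).Nonempty

/-- `B` is a play of Player II against the strategy `σ` of Player I: each `B n` is a
nonempty open subset of the set produced by `σ` from the previous moves of Player II. -/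
def IsPlayAgainst {X : Type*} [TopologicalSpace X] (σ : List (Set X) → Set X)
    (B : ℕ → Set X) : Prop :=
  ∀ n, IsOpen (B n) ∧ (B n).Nonempty ∧ B n ⊆ σ (List.ofFn (fun i : Fin n => B i))

/-- A winning strategy for Player I in the open-open game: every play of Player II against
it has dense union. -/
def WinningStrategy {X : Type*} [TopologicalSpace X] (σ : List (Set X) → Set X) : Prop :=
  ValidStrategy σ ∧ ∀ B : ℕ → Set X, IsPlayAgainst σ B → Dense (⋃ n, B n)

/-- A space is I-favorable if Player I has a winning strategy in the open-open game. -/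
def IFavorable (X : Type*) [TopologicalSpace X] : Prop :=
  ∃ σ : List (Set X) → Set X, WinningStrategy σ

/-- `P` is closed under the strategy `σ`. -/
def ClosedUnderStrategy {X : Type*} [TopologicalSpace X] (P : Set (Set X))
    (σ : List (Set X) → Set X) : Prop :=
  σ [] ∈ P ∧ ∀ l : List (Set X), (∀ b ∈ l, b ∈ P) → σ l ∈ P

/-- The limit of an inverse system, as the subspace of threads in the product. -/
abbrev invLimit {ι : Type*} [Preorder ι] (Y : ι → Type*)
    (bond : ∀ i j : ι, i ≤ j → Y j → Y i) : Type _ :=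
  {u : ∀ i, Y i // ∀ (i j : ι) (h : i ≤ j), bond i j h (u j) = u i}

/-- The topology of the inverse limit, with explicitly given topologies on factors. -/
def invLimitTop {ι : Type*} [Preorder ι] (Y : ι → Type*) (t : ∀ i, TopologicalSpace (Y i))
    (bond : ∀ i j : ι, i ≤ j → Y j → Y i) : TopologicalSpace (invLimit Y bond) :=
  @instTopologicalSpaceSubtype _ _ (@Pi.topologicalSpace ι Y t)

/-- σ-completeness of an inverse system: each countable chain of indices has a least upper
bound `l`, and the canonical map from `Y l` to the limit of the countable subsystem is a
homeomorphism (an embedding whose range is the set of threads). -/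
def SigmaComplete {ι : Type*} [Preorder ι] (Y : ι → Type*) (t : ∀ i, TopologicalSpace (Y i))
    (bond : ∀ i j : ι, i ≤ j → Y j → Y i) : Prop :=
  (∀ s : ℕ → ι, Monotone s → ∃ l, IsLUB (Set.range s) l) ∧
  ∀ (s : ℕ → ι) (hs : Monotone s) (l : ι) (hl : IsLUB (Set.range s) l),
    @IsEmbedding (Y l) (∀ n, Y (s n)) (t l) (@Pi.topologicalSpace ℕ _ (fun n => t (s n)))
      (fun x n => bond (s n) l (hl.1 (Set.mem_range_self n)) x) ∧
    Set.range (fun (x : Y l) (n : ℕ) => bond (s n) l (hl.1 (Set.mem_range_self n)) x) =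
      {u : ∀ n, Y (s n) | ∀ (n m : ℕ) (h : n ≤ m), bond (s n) (s m) (hs h) (u m) = u n}

/-- A σ-complete inverse system of topological spaces over a directed partial order,
with continuous surjective bonding maps. -/
structure TopInvSystem : Type 1 where
  ι : Type
  [ord : PartialOrder ι]
  directed : IsDirected ι (· ≤ ·)
  Y : ι → Type
  [t : ∀ i, TopologicalSpace (Y i)]
  bond : ∀ i j : ι, i ≤ j → Y j → Y i
  bond_refl : ∀ i (x : Y i), bond i i le_rfl x = x
  bond_comp : ∀ (i j k : ι) (hij : i ≤ j) (hjk : j ≤ k) (x : Y k),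
    bond i j hij (bond j k hjk x) = bond i k (hij.trans hjk) x
  bond_cont : ∀ (i j : ι) (h : i ≤ j), Continuous (bond i j h)
  bond_surj : ∀ (i j : ι) (h : i ≤ j), Function.Surjective (bond i j h)
  sigmaComplete : SigmaComplete Y t bond

instance (S : TopInvSystem) : PartialOrder S.ι := S.ord
instance (S : TopInvSystem) (i : S.ι) : TopologicalSpace (S.Y i) := S.t i

/-- The limit of a `TopInvSystem`. -/
def TopInvSystem.Limit (S : TopInvSystem) : Type := invLimit S.Y S.bond

instance (S : TopInvSystem) : TopologicalSpace S.Limit :=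
  inferInstanceAs (TopologicalSpace (invLimit S.Y S.bond))

/-- The bonding map `X/R → X/P` for `P ⊆ R`, sending `[x]_R` to `[x]_P`. -/
def pBond {X : Type*} (P R : Set (Set X)) (h : P ⊆ R) : pQuot R → pQuot P :=
  Quotient.lift (pMap P) (fun _ _ hab => Quotient.sound (fun V hV => hab V (h hV)))

/-- A `T`-club on a space `X` (with `T` the cozero sets): a collection of countable
subfamilies of `T`, each closed under a fixed winning strategy for Player I, closed under
finite unions and intersections, contained in its `seq`-family, which is cofinal among
countable subfamilies of `T` and closed under countable chains. -/
def TClub {X : Type*} [TopologicalSpace X] (C : Set (Set (Set X))) : Prop :=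
  ∃ σ : List (Set X) → Set X, WinningStrategy σ ∧
    (∀ P ∈ C, P.Countable ∧ P ⊆ cozeroFam X ∧ ClosedUnderStrategy P σ ∧
      (∀ A ∈ P, ∀ B ∈ P, A ∪ B ∈ P ∧ A ∩ B ∈ P) ∧ P ⊆ seqFam P) ∧
    (∀ Q : Set (Set X), Q.Countable → Q ⊆ cozeroFam X → ∃ P ∈ C, Q ⊆ P) ∧
    (∀ f : ℕ → Set (Set X), (∀ n, f n ∈ C) → Monotone f → (⋃ n, f n) ∈ C)


namespace Stmt16Aux

variable {X : Type} [TopologicalSpace X]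

/-- positivity set -/
def coz (f : C(X, ℝ)) : Set X := {x | 0 < f x}

lemma coz_open (f : C(X, ℝ)) : IsOpen (coz f) :=
  isOpen_lt continuous_const f.continuous

/-- One-step closure operations. -/
def G (h : List C(X, ℝ) → C(X, ℝ)) (l : List C(X, ℝ)) : Set C(X, ℝ) :=
  {1, h l} ∪ (⋃ f ∈ {f | f ∈ l}, ⋃ g ∈ {g | g ∈ l}, {f ⊓ g}) ∪
    (⋃ f ∈ {f | f ∈ l}, ⋃ q : ℚ, {f - ContinuousMap.const X (q : ℝ),
      ContinuousMap.const X (q : ℝ) - f})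

lemma G_countable (h : List C(X, ℝ) → C(X, ℝ)) (l : List C(X, ℝ)) : (G h l).Countable := by
  have hl : {f | f ∈ l}.Countable := (List.finite_toSet l).countable
  refine ((Set.toFinite _).countable.union ?_).union ?_
  · exact hl.biUnion fun f _ => hl.biUnion fun g _ => countable_singleton _
  · exact hl.biUnion fun f _ => countable_iUnion fun q => (Set.toFinite _).countable

/-- Good families. -/
def Good (h : List C(X, ℝ) → C(X, ℝ)) (A : Set C(X, ℝ)) : Prop :=
  A.Countable ∧ ∀ l : List C(X, ℝ), (∀ f ∈ l, f ∈ A) → G h l ⊆ A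

lemma list_mono {T : Type} (s : ℕ → Set T) (hs : Monotone s) (l : List T)
    (hl : ∀ f ∈ l, f ∈ ⋃ n, s n) : ∃ n, ∀ f ∈ l, f ∈ s n := by
  induction l with
  | nil => exact ⟨0, by simp⟩
  | cons a l ih =>
    obtain ⟨n, hn⟩ := ih fun f hf => hl f (List.mem_cons_of_mem _ hf)
    obtain ⟨m, hm⟩ := mem_iUnion.1 (hl a List.mem_cons_self)
    refine ⟨max n m, fun f hf => ?_⟩
    rcases List.mem_cons.1 hf with rfl | hf
    · exact hs (le_max_right _ _) hm
    · exact hs (le_max_left _ _) (hn f hf)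

lemma Good.iUnion {h : List C(X, ℝ) → C(X, ℝ)} (s : ℕ → Set C(X, ℝ)) (hs : Monotone s)
    (hg : ∀ n, Good h (s n)) : Good h (⋃ n, s n) := by
  refine ⟨countable_iUnion fun n => (hg n).1, fun l hl => ?_⟩
  obtain ⟨n, hn⟩ := list_mono s hs l hl
  exact ((hg n).2 l hn).trans (subset_iUnion s n)

lemma lists_countable {T : Type} {A : Set T} (hA : A.Countable) :
    {l : List T | ∀ f ∈ l, f ∈ A}.Countable := by
  have := hA.to_subtype
  refine (countable_range (fun l : List A => l.map Subtype.val)).mono ?_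
  intro l hl
  exact ⟨l.attachWith (· ∈ A) hl, by simp⟩

lemma exists_good (h : List C(X, ℝ) → C(X, ℝ)) (Q : Set C(X, ℝ)) (hQ : Q.Countable) :
    ∃ A, Good h A ∧ Q ⊆ A := by
  let s : ℕ → Set C(X, ℝ) := fun n => Nat.rec Q
    (fun _ A => A ∪ ⋃ l ∈ {l : List C(X, ℝ) | ∀ f ∈ l, f ∈ A}, G h l) n
  have hs1 : ∀ n, s (n+1) = s n ∪ ⋃ l ∈ {l : List C(X, ℝ) | ∀ f ∈ l, f ∈ s n}, G h l :=
    fun n => rfl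
  have hm : Monotone s := monotone_nat_of_le_succ fun n => by
    rw [hs1]; exact subset_union_left
  have hc : ∀ n, (s n).Countable := by
    intro n
    induction n with
    | zero => exact hQ
    | succ n ih =>
      rw [hs1]
      exact ih.union ((lists_countable ih).biUnion fun l _ => G_countable h l)
  refine ⟨⋃ n, s n, ⟨countable_iUnion hc, fun l hl => ?_⟩, subset_iUnion s 0⟩
  obtain ⟨n, hn⟩ := list_mono s hm l hl
  refine Subset.trans ?_ (subset_iUnion s (n+1))
  rw [hs1]
  exact Subset.trans (subset_biUnion_of_mem (u := G h) (show l ∈ {l | ∀ f ∈ l, f ∈ s n} from hn))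
    subset_union_right

/-- The evaluation map. -/
def ev (A : Set C(X, ℝ)) (x : X) : A → ℝ := fun f => f.1 x

lemma ev_cont (A : Set C(X, ℝ)) : Continuous (ev A) :=
  continuous_pi fun f => f.1.continuous

/-- The quotient space. -/
abbrev Y (A : Set C(X, ℝ)) : Type := Set.range (ev A)

def proj (A : Set C(X, ℝ)) (x : X) : Y A := ⟨ev A x, mem_range_self x⟩

lemma proj_cont (A : Set C(X, ℝ)) : Continuous (proj A) := (ev_cont A).subtype_mk _

lemma proj_surj (A : Set C(X, ℝ)) : Function.Surjective (proj A) := by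
  rintro ⟨_, x, rfl⟩; exact ⟨x, rfl⟩

lemma proj_eq {A : Set C(X, ℝ)} {x y : X} :
    proj A x = proj A y ↔ ∀ f ∈ A, f x = f y := by
  constructor
  · intro h f hf
    exact congrFun (congrArg Subtype.val h) ⟨f, hf⟩
  · intro h
    exact Subtype.ext (funext fun f => h f.1 f.2)

def bnd (A B : Set C(X, ℝ)) (h : A ⊆ B) (y : Y B) : Y A :=
  ⟨fun f => y.1 ⟨f.1, h f.2⟩, by
    obtain ⟨_, x, rfl⟩ := y; exact ⟨x, rfl⟩⟩

lemma bnd_proj (A B : Set C(X, ℝ)) (h : A ⊆ B) (x : X) : bnd A B h (proj B x) = proj A x := rfl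

lemma bnd_cont (A B : Set C(X, ℝ)) (h : A ⊆ B) : Continuous (bnd A B h) := by
  refine Continuous.subtype_mk (continuous_pi fun f => ?_) _
  exact (continuous_apply (⟨f.1, h f.2⟩ : B)).comp continuous_subtype_val

lemma bnd_surj (A B : Set C(X, ℝ)) (h : A ⊆ B) : Function.Surjective (bnd A B h) := by
  intro y
  obtain ⟨x, rfl⟩ := proj_surj A y
  exact ⟨proj B x, rfl⟩

lemma good_base {h : List C(X, ℝ) → C(X, ℝ)} {A : Set C(X, ℝ)} (hA : Good h A)
    (U : Set (Y A)) (hU : IsOpen U) (x : X) (hx : proj A x ∈ U) :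
    ∃ g ∈ A, x ∈ coz g ∧ coz g ⊆ proj A ⁻¹' U := by
  have hone : (1 : C(X, ℝ)) ∈ A := hA.2 [] (by simp) (by simp [G])
  have hinf : ∀ f ∈ A, ∀ g ∈ A, f ⊓ g ∈ A := fun f hf g hg => by
    refine hA.2 [f, g] (by simp [hf, hg]) (Or.inl (Or.inr ?_))
    simp only [mem_iUnion]
    exact ⟨f, by simp, g, by simp, rfl⟩
  have hsub : ∀ f ∈ A, ∀ q : ℚ, f - ContinuousMap.const X (q : ℝ) ∈ A ∧
      ContinuousMap.const X (q : ℝ) - f ∈ A := fun f hf q => by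
    constructor <;>
    · refine hA.2 [f] (by simp [hf]) (Or.inr ?_)
      simp only [mem_iUnion]
      exact ⟨f, by simp, q, by simp⟩
  obtain ⟨O, hO, rfl⟩ := isOpen_induced_iff.1 hU
  obtain ⟨I, u, hu, hIu⟩ := isOpen_pi_iff.1 hO _ hx
  have key : ∀ J : Finset A, J ⊆ I → ∃ g ∈ A, x ∈ coz g ∧ ∀ y ∈ coz g, ∀ f ∈ J, f.1 y ∈ u f := by
    intro J
    classical
    induction J using Finset.induction_on with
    | empty => exact fun _ => ⟨1, hone, by simp [coz], by simp⟩
    | insert f J hf ih =>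
      intro hJ
      obtain ⟨g, hg, hxg, hgu⟩ := ih fun a ha => hJ (Finset.mem_insert_of_mem ha)
      obtain ⟨ho, hm⟩ := hu f (hJ (Finset.mem_insert_self _ _))
      obtain ⟨ε, hε, hball⟩ := Metric.isOpen_iff.1 ho _ hm
      have hm' : f.1 x = (proj A x).1 f := rfl
      rw [← hm', Real.ball_eq_Ioo] at hball
      obtain ⟨p, hp1, hp2⟩ := exists_rat_btwn (show f.1 x - ε < f.1 x by linarith)
      obtain ⟨q, hq1, hq2⟩ := exists_rat_btwn (show f.1 x < f.1 x + ε by linarith)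
      refine ⟨(f.1 - ContinuousMap.const X (p : ℝ)) ⊓ (ContinuousMap.const X (q : ℝ) - f.1) ⊓ g,
        hinf _ (hinf _ (hsub _ f.2 p).1 _ (hsub _ f.2 q).2) _ hg, ?_, ?_⟩
      · simp only [coz, mem_ofPred_eq] at hxg
        simp [coz, hxg, hp2, hq1]
      · intro y hy f' hf'
        simp only [coz, mem_ofPred_eq, ContinuousMap.inf_apply, lt_inf_iff,
          ContinuousMap.sub_apply, ContinuousMap.const_apply, sub_pos] at hy
        rcases Finset.mem_insert.1 hf' with rfl | hf'
        · exact hball ⟨by linarith [hy.1.1], by linarith [hy.1.2]⟩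
        · exact hgu y hy.2 f' hf'
  obtain ⟨g, hg, hxg, hgu⟩ := key I (Finset.Subset.refl _)
  exact ⟨g, hg, hxg, fun y hy => hIu fun f hf => hgu y hy f hf⟩

lemma good_skeletal {σ : List (Set X) → Set X} (hσ : WinningStrategy σ)
    {h : List C(X, ℝ) → C(X, ℝ)}
    (hh : ∀ l, (coz (h l)).Nonempty ∧ coz (h l) ⊆ σ (l.map coz))
    {A : Set C(X, ℝ)} (hA : Good h A) (V : Set X) (hV : IsOpen V) (hne : V.Nonempty) :
    (interior (closure (proj A '' V))).Nonempty := by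
  by_contra hcon
  rw [not_nonempty_iff_eq_empty, ← Set.compl_univ_iff, ← closure_compl,
    ← dense_iff_closure_eq] at hcon
  have hstep : ∀ l : List C(X, ℝ), ∃ g : C(X, ℝ), (∀ f ∈ l, f ∈ A) →
      g ∈ A ∧ (coz g).Nonempty ∧ coz g ⊆ σ (l.map coz) ∧ Disjoint (coz g) V := by
    intro l
    by_cases hl : ∀ f ∈ l, f ∈ A
    swap
    · exact ⟨0, fun h => absurd h hl⟩
    have hhA : h l ∈ A := hA.2 l hl (by simp [G])
    let W : Set (Y A) := {y | 0 < y.1 ⟨h l, hhA⟩}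
    have hW : IsOpen W :=
      isOpen_lt continuous_const ((continuous_apply _).comp continuous_subtype_val)
    obtain ⟨x0, hx0⟩ := (hh l).1
    obtain ⟨y, hyW, hy⟩ := hcon.inter_open_nonempty W hW ⟨proj A x0, hx0⟩
    obtain ⟨x, rfl⟩ := proj_surj A y
    obtain ⟨g, hg, hxg, hgs⟩ := good_base hA (W ∩ (closure (proj A '' V))ᶜ)
      (hW.inter isClosed_closure.isOpen_compl) x ⟨hyW, hy⟩
    refine ⟨g, fun _ => ⟨hg, ⟨x, hxg⟩, fun z hz => (hh l).2 (hgs hz).1, ?_⟩⟩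
    rw [Set.disjoint_left]
    exact fun z hz hzV => (hgs hz).2 (subset_closure ⟨z, hzV, rfl⟩)
  choose step hstep using hstep
  let L : ℕ → List C(X, ℝ) := fun n => Nat.rec [] (fun _ l => l ++ [step l]) n
  have hL1 : ∀ n, L (n+1) = L n ++ [step (L n)] := fun n => rfl
  have hLA : ∀ n, ∀ f ∈ L n, f ∈ A := by
    intro n
    induction n with
    | zero => intro f hf; simp [L] at hf
    | succ n ih =>
      intro f hf
      rw [hL1, List.mem_append, List.mem_singleton] at hf
      rcases hf with hf | rfl
      · exact ih f hf
      · exact (hstep _ ih).1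
  have hof : ∀ n, List.ofFn (fun i : Fin n => coz (step (L i))) = (L n).map coz := by
    intro n
    induction n with
    | zero => simp [L]
    | succ n ih => 
      rw [List.ofFn_succ', hL1, List.map_append, ← ih]
      simp
  have hd := hσ.2 (fun n => coz (step (L n))) (fun n => by
    refine ⟨coz_open _, (hstep _ (hLA n)).2.1, ?_⟩
    have := (hstep _ (hLA n)).2.2.1
    rw [← hof] at this
    exact this)
  obtain ⟨x, hxV, hx⟩ := hd.inter_open_nonempty V hV hne
  obtain ⟨n, hn⟩ := mem_iUnion.1 hx
  exact Set.disjoint_left.1 (hstep _ (hLA n)).2.2.2 hn hxV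

lemma exists_h [CompactSpace X] [T2Space X] {σ : List (Set X) → Set X} (hσ : WinningStrategy σ) :
    ∃ h : List C(X, ℝ) → C(X, ℝ),
      ∀ l, (coz (h l)).Nonempty ∧ coz (h l) ⊆ σ (l.map coz) := by
  have : ∀ l : List C(X, ℝ), ∃ g : C(X, ℝ), (coz g).Nonempty ∧ coz g ⊆ σ (l.map coz) := by
    intro l
    obtain ⟨ho, x, hx⟩ := hσ.1 (l.map coz)
    obtain ⟨f, hf0, hf1, -⟩ := exists_continuous_zero_one_of_isClosed (s := (σ (l.map coz))ᶜ)
      (t := {x}) ho.isClosed_compl isClosed_singleton (by simpa using hx)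
    refine ⟨f, ⟨x, ?_⟩, fun y hy => ?_⟩
    · have := hf1 (mem_singleton x)
      simp [coz, this]
    · by_contra hc
      have := hf0 hc
      simp only [coz, mem_ofPred_eq] at hy
      simp [this] at hy
  choose h hh using this
  exact ⟨h, hh⟩

/-- Threads over a directed family come from a point. -/
lemma thread [CompactSpace X] {J : Type} [Nonempty J] (s : J → Set C(X, ℝ))
    (hdir : Directed (· ⊆ ·) s)
    (u : ∀ j, Y (s j)) (hu : ∀ i j (hij : s i ⊆ s j), bnd (s i) (s j) hij (u j) = u i) :
    ∃ x, ∀ j, proj (s j) x = u j := by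
  have := IsCompact.nonempty_iInter_of_directed_nonempty_isCompact_isClosed
    (fun j => proj (s j) ⁻¹' {u j}) (by
      intro i j
      obtain ⟨k, hik, hjk⟩ := hdir i j
      refine ⟨k, fun x hx => ?_, fun x hx => ?_⟩
      · have hx : proj (s k) x = u k := hx
        show proj (s i) x = u i
        rw [← hu i k hik, ← hx, bnd_proj]
      · have hx : proj (s k) x = u k := hx
        show proj (s j) x = u j
        rw [← hu j k hjk, ← hx, bnd_proj])
    (fun j => (proj_surj _ (u j)))
    (fun j => (isClosed_singleton.preimage (proj_cont _)).isCompact)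
    (fun j => isClosed_singleton.preimage (proj_cont _))
  obtain ⟨x, hx⟩ := this
  exact ⟨x, fun j => mem_iInter.1 hx j⟩

instance [CompactSpace X] (A : Set C(X, ℝ)) : CompactSpace (Y A) :=
  isCompact_iff_compactSpace.1 (isCompact_range (ev_cont A))

lemma sigma_complete [CompactSpace X] (h : List C(X, ℝ) → C(X, ℝ)) :
    SigmaComplete (ι := {A : Set C(X, ℝ) // Good h A}) (fun A => Y A.1) (fun _ => inferInstance)
      (fun A B hAB => bnd A.1 B.1 hAB) := by
  have hlub : ∀ s : ℕ → {A : Set C(X, ℝ) // Good h A}, ∀ hs : Monotone s,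
      IsLUB (Set.range s) ⟨⋃ n, (s n).1, Good.iUnion _ hs fun n => (s n).2⟩ := by
    intro s hs
    constructor
    · rintro _ ⟨n, rfl⟩
      exact subset_iUnion (fun n => (s n).1) n
    · intro b hb
      exact iUnion_subset fun n => hb (mem_range_self n)
  refine ⟨fun s hs => ⟨_, hlub s hs⟩, ?_⟩
  intro s hs l hl
  have hle := hl.unique (hlub s hs)
  refine ⟨?_, ?_⟩
  · refine (Continuous.isClosedEmbedding (continuous_pi fun n => bnd_cont _ _ _) ?_).isEmbedding
    intro y z hyz
    obtain ⟨x, rfl⟩ := proj_surj _ y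
    obtain ⟨w, rfl⟩ := proj_surj _ z
    rw [proj_eq]
    intro f hf
    rw [hle] at hf
    obtain ⟨n, hn⟩ := mem_iUnion.1 hf
    have := congrFun hyz n
    simp only [bnd_proj] at this
    exact proj_eq.1 this f hn
  · ext u
    constructor
    · rintro ⟨y, rfl⟩ n m hnm
      rfl
    · intro hu
      have hth : ∀ i j (hij : (s i).1 ⊆ (s j).1), bnd (s i).1 (s j).1 hij (u j) = u i := by
        intro i j hij
        rcases le_total i j with hle | hle
        · exact hu i j hle
        · have e : s i = s j := le_antisymm hij (hs hle)
          have h2 := hu j i hle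
          rw [← h2]
          apply Subtype.ext
          funext f
          rfl
      obtain ⟨x, hx⟩ := thread (fun n => (s n).1)
        (directed_of_isDirected_le (fun i j hij => hs hij)) u hth
      exact ⟨proj _ x, funext fun n => hx n⟩

end Stmt16Aux

open Stmt16Aux

theorem stmt16 (X : Type) [TopologicalSpace X] [CompactSpace X] [T2Space X]
    (hfav : IFavorable X) :
    ∃ S : TopInvSystem,
      (∀ i, CompactSpace (S.Y i)) ∧
      (∀ i, TopologicalSpace.MetrizableSpace (S.Y i)) ∧
      (∀ (i j : S.ι) (h : i ≤ j), IsSkeletal (S.bond i j h)) ∧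
      Nonempty (X ≃ₜ S.Limit) := by
  obtain ⟨σ, hσ⟩ := hfav
  obtain ⟨h, hh⟩ := exists_h hσ
  have hdir : ∀ A B : {A : Set C(X, ℝ) // Good h A}, ∃ C, A ≤ C ∧ B ≤ C := by
    intro A B
    obtain ⟨C, hC, hABC⟩ := exists_good h (A.1 ∪ B.1) (A.2.1.union B.2.1)
    exact ⟨⟨C, hC⟩, subset_union_left.trans hABC, subset_union_right.trans hABC⟩
  let S : TopInvSystem :=
    { ι := {A : Set C(X, ℝ) // Good h A}
      directed := ⟨hdir⟩
      Y := fun A => Y A.1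
      bond := fun A B hAB => bnd A.1 B.1 hAB
      bond_refl := fun _ _ => rfl
      bond_comp := fun _ _ _ _ _ _ => rfl
      bond_cont := fun _ _ _ => bnd_cont _ _ _
      bond_surj := fun _ _ _ => bnd_surj _ _ _
      sigmaComplete := sigma_complete h }
  refine ⟨S, fun i => ?_, fun i => ?_, fun i j hij =>
    ⟨S.bond_cont i j hij, S.bond_surj i j hij, ?_⟩, ?_⟩
  · exact inferInstanceAs (CompactSpace (Y i.1))
  · have : Countable i.1 := i.2.1.to_subtype
    exact inferInstanceAs (TopologicalSpace.MetrizableSpace (Y i.1))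
  · intro U hU hne
    have h1 := good_skeletal hσ hh i.2 (proj j.1 ⁻¹' U) (hU.preimage (proj_cont _))
      (hne.preimage (proj_surj _))
    have h2 : proj i.1 '' (proj j.1 ⁻¹' U) = bnd i.1 j.1 hij '' U := by
      conv_rhs => rw [← image_preimage_eq U (proj_surj j.1), image_image]
      rfl
    rw [h2] at h1
    exact h1
  · let F : X → invLimit S.Y S.bond := fun x => ⟨fun A => proj A.1 x, fun _ _ _ => rfl⟩
    have hF : Continuous F := (continuous_pi fun A : S.ι => proj_cont A.1).subtype_mk _
    have hFb : Function.Bijective F := by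
      constructor
      · intro x y hxy
        by_contra hne
        obtain ⟨f, hf0, hf1, -⟩ := exists_continuous_zero_one_of_isClosed (s := {x})
          (t := {y}) isClosed_singleton isClosed_singleton (by simpa using hne)
        obtain ⟨A, hA, hfA⟩ := exists_good h {f} (countable_singleton _)
        have h1 : proj A x = proj A y := congrFun (congrArg Subtype.val hxy) ⟨A, hA⟩
        have h2 := proj_eq.1 h1 f (hfA rfl)
        rw [hf0 rfl, hf1 rfl] at h2
        simp at h2
      · intro u
        have : Nonempty {A : Set C(X, ℝ) // Good h A} := by
          obtain ⟨A, hA, -⟩ := exists_good h ∅ countable_empty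
          exact ⟨⟨A, hA⟩⟩
        obtain ⟨x, hx⟩ := thread (fun A : {A : Set C(X, ℝ) // Good h A} => A.1)
          (fun A B => hdir A B) u.1 (fun i j hij => u.2 i j hij)
        exact ⟨x, Subtype.ext (funext fun A => hx A)⟩
    have : ∀ i, T2Space (S.Y i) := fun i => inferInstanceAs (T2Space (Y i.1))
    exact ⟨(Continuous.homeoOfEquivCompactToT2 (f := Equiv.ofBijective F hFb) hF :
      X ≃ₜ invLimit S.Y S.bond)⟩
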